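/- Let U be a smooth real-valued function on an open set S ⊆ C satisfying for all I, J: ∇_I × ∇_J U = 0⃗ (i.e. ∑_{i,j} ε_{kij} ∂_{I,i}∂_{J,j} U = 0 for each k), ∑_K x⃗^K × ∇_K U = 0⃗, and ∑_K x⃗^K · ∇_K U = U. Define U_{IJ} := ¼ ∇_I · ∇_J U on S. Then at every point of S: U_{IJ} = U_{JI}; ∇_I U_{KJ} = ∇_J U_{KI} for all I, J, K; ∑_K x⃗^K × ∇_K U_{IJ} = 0⃗; ∑_K x⃗^K · ∇_K U_{IJ} = −U_{IJ}; and 2 ∑_{I,J} U_{IJ} (x⃗^I · x⃗^J) = U. -/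

import Mathlib

/-- The configuration space of `m` points in `ℝ³`. -/
abbrev Conf (m : ℕ) := Fin m → Fin 3 → ℝ

/-- Standard basis vector `e_{K,i}` of the configuration space. -/
noncomputable def e {m : ℕ} (K : Fin m) (i : Fin 3) : Conf m :=
  Pi.single K (Pi.single i 1)

/-- The partial derivative `∂_{K,i}` along the basis vector `e_{K,i}`. -/
noncomputable def pd {m : ℕ} (K : Fin m) (i : Fin 3) (f : Conf m → ℝ) : Conf m → ℝ :=
  fun x => fderiv ℝ f x (e K i)

/-- Standard dot product on `ℝ³`. -/
noncomputable def dot3 (a b : Fin 3 → ℝ) : ℝ := ∑ i, a i * b i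

/-- The Levi-Civita symbol on `Fin 3`, with `ε 0 1 2 = 1`. -/
noncomputable def eps (k i j : Fin 3) : ℝ :=
  ((i : ℝ) - (k : ℝ)) * ((j : ℝ) - (k : ℝ)) * ((j : ℝ) - (i : ℝ)) / 2

/-- Standard cross product on `ℝ³`: `(a × b)_k = ∑_{i,j} ε_{kij} aᵢ bⱼ`. -/
noncomputable def cross3 (a b : Fin 3 → ℝ) : Fin 3 → ℝ :=
  fun k => ∑ i, ∑ j, eps k i j * a i * b j

/-- `∇_K f` : the `ℝ³`-valued gradient with respect to the `K`-th point. -/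
noncomputable def grad {m : ℕ} (K : Fin m) (f : Conf m → ℝ) : Conf m → Fin 3 → ℝ :=
  fun x i => pd K i f x

/-- The generator of simultaneous scalings: `L₀ f = ∑_K x⃗^K · ∇_K f`. -/
noncomputable def L0 {m : ℕ} (f : Conf m → ℝ) : Conf m → ℝ :=
  fun x => ∑ K, dot3 (x K) (grad K f x)

/-- The generators of rigid rotations: `Lᵢ f = −∑_K (x⃗^K × ∇_K f)ᵢ`,
for `i = 0, 1, 2` (playing the role of `1, 2, 3`). -/
noncomputable def Lrot {m : ℕ} (i : Fin 3) (f : Conf m → ℝ) : Conf m → ℝ :=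
  fun x => -∑ K, cross3 (x K) (grad K f x) i

/-- The derivative of `f` along the linear vector field `x ↦ (cᵀ x⃗^K)_K`. -/
noncomputable def linField {m : ℕ} (c : Fin 3 → Fin 3 → ℝ) (f : Conf m → ℝ) : Conf m → ℝ :=
  fun x => ∑ K, ∑ i, ∑ j, c i j * x K i * pd K j f x

theorem pd_congr {m : ℕ} {S : Set (Conf m)} (hS : IsOpen S) {f g : Conf m → ℝ}
    (h : ∀ x ∈ S, f x = g x) {x : Conf m} (hx : x ∈ S) (K : Fin m) (i : Fin 3) :
    pd K i f x = pd K i g x := by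
  have : f =ᶠ[nhds x] g := Filter.eventuallyEq_of_mem (hS.mem_nhds hx) h
  simp only [pd, this.fderiv_eq]

theorem ContDiffOn.pd {m : ℕ} {S : Set (Conf m)} (hS : IsOpen S) {f : Conf m → ℝ}
    (hf : ContDiffOn ℝ (⊤ : ℕ∞) f S) (K : Fin m) (i : Fin 3) :
    ContDiffOn ℝ (⊤ : ℕ∞) (pd K i f) S :=
  (hf.fderiv_of_isOpen (m := (⊤ : ℕ∞)) hS le_rfl).clm_apply contDiffOn_const

theorem ContDiffOn.differentiableAt_of_isOpen {m : ℕ} {S : Set (Conf m)} (hS : IsOpen S)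
    {f : Conf m → ℝ} (hf : ContDiffOn ℝ (⊤ : ℕ∞) f S) {x : Conf m} (hx : x ∈ S) :
    DifferentiableAt ℝ f x :=
  (hf.contDiffAt (hS.mem_nhds hx)).differentiableAt (by simp)

theorem pd_comm {m : ℕ} {S : Set (Conf m)} (hS : IsOpen S) {f : Conf m → ℝ}
    (hf : ContDiffOn ℝ (⊤ : ℕ∞) f S) {x : Conf m} (hx : x ∈ S) (K L : Fin m) (i j : Fin 3) :
    pd K i (pd L j f) x = pd L j (pd K i f) x := by
  have hsymm : IsSymmSndFDerivAt ℝ f x :=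
    (hf.contDiffAt (hS.mem_nhds hx)).isSymmSndFDerivAt
      (by simpa using WithTop.coe_le_coe.2 (le_top : (2 : ℕ∞) ≤ ⊤))
  have hd : DifferentiableAt ℝ (fderiv ℝ f) x :=
    ((hf.fderiv_of_isOpen (m := (⊤ : ℕ∞)) hS le_rfl).contDiffAt
      (hS.mem_nhds hx)).differentiableAt (by simp)
  have key (v w : Conf m) :
      fderiv ℝ (fun y => fderiv ℝ f y v) x w = fderiv ℝ (fderiv ℝ f) x w v := by
    rw [fderiv_clm_apply hd (differentiableAt_const v)]
    simp
  change fderiv ℝ (fun y => fderiv ℝ f y (e L j)) x (e K i)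
    = fderiv ℝ (fun y => fderiv ℝ f y (e K i)) x (e L j)
  rw [key, key, hsymm]

theorem pd_sum {m : ℕ} {ι : Type*} (s : Finset ι) {g : ι → Conf m → ℝ} {x : Conf m}
    (hg : ∀ l ∈ s, DifferentiableAt ℝ (g l) x) (K : Fin m) (i : Fin 3) :
    pd K i (fun y => ∑ l ∈ s, g l y) x = ∑ l ∈ s, pd K i (g l) x := by
  simp only [pd]
  rw [fderiv_fun_sum hg]
  simp

theorem pd_const_mul {m : ℕ} (a : ℝ) {g : Conf m → ℝ} {x : Conf m}
    (hg : DifferentiableAt ℝ g x) (K : Fin m) (i : Fin 3) :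
    pd K i (fun y => a * g y) x = a * pd K i g x := by
  simp only [pd]
  rw [fderiv_const_mul hg]
  simp

theorem pd_coord_mul {m : ℕ} {g : Conf m → ℝ} {x : Conf m}
    (hg : DifferentiableAt ℝ g x) (J K : Fin m) (l i : Fin 3) :
    pd J l (fun y => y K i * g y) x
      = (if K = J then if i = l then g x else 0 else 0) + x K i * pd J l g x := by
  have hc : HasFDerivAt (fun y : Conf m => y K i)
      ((ContinuousLinearMap.proj (R := ℝ) (φ := fun _ : Fin 3 => ℝ) i).comp
        (ContinuousLinearMap.proj (R := ℝ) (φ := fun _ : Fin m => Fin 3 → ℝ) K)) x :=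
    ((ContinuousLinearMap.proj (R := ℝ) (φ := fun _ : Fin 3 => ℝ) i).comp
        (ContinuousLinearMap.proj (R := ℝ) (φ := fun _ : Fin m => Fin 3 → ℝ) K)).hasFDerivAt
  simp only [pd]
  rw [(hc.fun_mul hg.hasFDerivAt).fderiv]
  by_cases h : K = J
  · subst h
    by_cases h' : i = l <;> simp [e, h', add_comm]
  · simp [e, h]

theorem linField_const_mul_sum {m : ℕ} (c : Fin 3 → Fin 3 → ℝ) (a : ℝ)
    {g : Fin 3 → Conf m → ℝ} {x : Conf m} (hg : ∀ l, DifferentiableAt ℝ (g l) x) :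
    linField c (fun y => a * ∑ l, g l y) x = a * ∑ l, linField c (g l) x := by
  have h (K : Fin m) (j : Fin 3) :
      pd K j (fun y => a * ∑ l, g l y) x = a * ∑ l, pd K j (g l) x := by
    rw [pd_const_mul a (DifferentiableAt.fun_sum fun l _ => hg l), pd_sum _ fun l _ => hg l]
  simp only [linField, h]
  simp only [Fin.sum_univ_three, Finset.mul_sum, ← Finset.sum_add_distrib]
  refine Finset.sum_congr rfl fun K _ => ?_
  ring

theorem pd_linField {m : ℕ} {S : Set (Conf m)} (hS : IsOpen S) {f : Conf m → ℝ}
    (hf : ContDiffOn ℝ (⊤ : ℕ∞) f S) {x : Conf m} (hx : x ∈ S) (c : Fin 3 → Fin 3 → ℝ)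
    (J : Fin m) (l : Fin 3) :
    pd J l (linField c f) x = ∑ j, c l j * pd J j f x + linField c (pd J l f) x := by
  have hd (K : Fin m) (j : Fin 3) : DifferentiableAt ℝ (pd K j f) x :=
    (hf.pd hS K j).differentiableAt_of_isOpen hS hx
  have hm (K : Fin m) (i j : Fin 3) :
      DifferentiableAt ℝ (fun y : Conf m => y K i * pd K j f y) x :=
    DifferentiableAt.mul (by fun_prop) (hd K j)
  have hmc (K : Fin m) (i j : Fin 3) :
      DifferentiableAt ℝ (fun y : Conf m => c i j * (y K i * pd K j f y)) x :=
    (hm K i j).const_mul _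
  unfold linField
  simp only [mul_assoc]
  rw [pd_sum _ fun K _ => DifferentiableAt.fun_sum fun i _ =>
    DifferentiableAt.fun_sum fun j _ => hmc K i j]
  have h (K : Fin m) : pd J l (fun y => ∑ i, ∑ j, c i j * (y K i * pd K j f y)) x
      = (if K = J then ∑ j, c l j * pd K j f x else 0)
        + ∑ i, ∑ j, c i j * (x K i * pd K j (pd J l f) x) := by
    rw [pd_sum _ fun i _ => DifferentiableAt.fun_sum fun j _ => hmc K i j]
    simp_rw [pd_sum _ fun j _ => hmc K _ j, pd_const_mul _ (hm K _ _), pd_coord_mul (hd K _),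
      pd_comm hS hf hx J K, mul_add, Finset.sum_add_distrib]
    congr 1
    split_ifs with hK
    · rw [Finset.sum_eq_single l] <;> simp +contextual
    · simp
  simp only [h, Finset.sum_add_distrib, Finset.sum_ite_eq', Finset.mem_univ, if_true]

theorem pd_pd_linField {m : ℕ} {S : Set (Conf m)} (hS : IsOpen S) {f : Conf m → ℝ}
    (hf : ContDiffOn ℝ (⊤ : ℕ∞) f S) {x : Conf m} (hx : x ∈ S) (c : Fin 3 → Fin 3 → ℝ)
    (I J : Fin m) (l n : Fin 3) :
    pd I n (pd J l (linField c f)) x = ∑ j, c l j * pd I n (pd J j f) x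
      + ∑ j, c n j * pd I j (pd J l f) x + linField c (pd I n (pd J l f)) x := by
  have hd (j : Fin 3) : DifferentiableAt ℝ (pd J j f) x :=
    (hf.pd hS J j).differentiableAt_of_isOpen hS hx
  have hl : DifferentiableAt ℝ (linField c (pd J l f)) x := by
    unfold linField
    exact DifferentiableAt.fun_sum fun K _ => DifferentiableAt.fun_sum fun i _ =>
      DifferentiableAt.fun_sum fun j _ => DifferentiableAt.mul (by fun_prop)
        (((hf.pd hS J l).pd hS K j).differentiableAt_of_isOpen hS hx)
  rw [pd_congr hS (fun y hy => pd_linField hS hf hy c J l) hx, add_assoc,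
    ← pd_linField hS (hf.pd hS J l) hx c I n]
  have hs : DifferentiableAt ℝ (fun y => ∑ j, c l j * pd J j f y) x :=
    DifferentiableAt.fun_sum fun j _ => (hd j).const_mul _
  have hadd : pd I n (fun y => ∑ j, c l j * pd J j f y + linField c (pd J l f) y) x
      = pd I n (fun y => ∑ j, c l j * pd J j f y) x + pd I n (linField c (pd J l f)) x := by
    simp only [pd] at hs hl ⊢
    rw [fderiv_fun_add hs hl]
    simp
  rw [hadd, pd_sum _ fun j _ => (hd j).const_mul _]
  simp_rw [pd_const_mul _ (hd _)]

theorem sum_cross3_grad {m : ℕ} (f : Conf m → ℝ) (x : Conf m) (k : Fin 3) :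
    ∑ K, cross3 (x K) (grad K f x) k = linField (eps k) f x := rfl

theorem sum_dot3_grad {m : ℕ} (f : Conf m → ℝ) (x : Conf m) :
    ∑ K, dot3 (x K) (grad K f x) = linField (fun i j => if i = j then 1 else 0) f x := by
  simp [linField, dot3, grad]

theorem pd_pd_swap_of_curl_eq_zero {m : ℕ} {f : Conf m → ℝ} {x : Conf m} {I J : Fin m}
    (h : ∀ k, ∑ i, ∑ j, eps k i j * pd I i (pd J j f) x = 0) (i j : Fin 3) :
    pd I i (pd J j f) x = pd I j (pd J i f) x := by
  have h0 := h 0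
  have h1 := h 1
  have h2 := h 2
  simp [Fin.sum_univ_three, eps] at h0 h1 h2
  fin_cases i <;> fin_cases j <;> simp <;> linarith

/-- from a potential `U` satisfying `∇_I × ∇_J U = 0`, rotation
invariance and homogeneity of degree `1`, the Higgs field
`U_{IJ} = ¼ ∇_I · ∇_J U` is symmetric, satisfies the first Bogomolny-type
integrability equations and the symmetry constraints, and reproduces `U`
through `2 ∑ U_{IJ} (x⃗^I · x⃗^J) = U`. -/
theorem stmt7 {m : ℕ} (hm : 1 ≤ m) (S : Set (Conf m)) (hS : IsOpen S)
    (U : Conf m → ℝ) (hsmooth : ContDiffOn ℝ (⊤ : ℕ∞) U S)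
    (hcurl : ∀ I J : Fin m, ∀ x ∈ S, ∀ k : Fin 3,
      ∑ i : Fin 3, ∑ j : Fin 3, eps k i j * pd I i (pd J j U) x = 0)
    (hrot : ∀ x ∈ S, ∀ k : Fin 3,
      ∑ K : Fin m, cross3 (x K) (grad K U x) k = 0)
    (hhom : ∀ x ∈ S, ∑ K : Fin m, dot3 (x K) (grad K U x) = U x)
    (UIJ : Fin m → Fin m → Conf m → ℝ)
    (hUIJ : ∀ I J, UIJ I J = fun x => (1/4) * ∑ i : Fin 3, pd I i (pd J i U) x) :
    ∀ x ∈ S,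
      (∀ I J : Fin m, UIJ I J x = UIJ J I x) ∧
      (∀ I J K : Fin m, ∀ i : Fin 3, pd I i (UIJ K J) x = pd J i (UIJ K I) x) ∧
      (∀ I J : Fin m, ∀ k : Fin 3,
        ∑ K : Fin m, cross3 (x K) (grad K (UIJ I J) x) k = 0) ∧
      (∀ I J : Fin m,
        ∑ K : Fin m, dot3 (x K) (grad K (UIJ I J) x) = -(UIJ I J x)) ∧
      (2 * ∑ I : Fin m, ∑ J : Fin m, UIJ I J x * dot3 (x I) (x J) = U x) := by
  have hswap (I J : Fin m) (x) (hx : x ∈ S) := pd_pd_swap_of_curl_eq_zero (hcurl I J x hx)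
  have hd1 (J : Fin m) (j : Fin 3) := hsmooth.pd hS J j
  have hd2 (I J : Fin m) (i j : Fin 3) := (hd1 J j).pd hS I i
  simp only [sum_cross3_grad] at hrot ⊢
  simp only [sum_dot3_grad] at hhom ⊢
  have hlin (c : Fin 3 → Fin 3 → ℝ) (I J : Fin m) (x) (hx : x ∈ S) :
      linField c (UIJ I J) x = (1 / 4) * ∑ l, linField c (pd I l (pd J l U)) x := by
    rw [hUIJ]
    exact linField_const_mul_sum c _ fun l => (hd2 I J l l).differentiableAt_of_isOpen hS hx
  have hpd (K J I : Fin m) (i : Fin 3) (x) (hx : x ∈ S) :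
      pd I i (UIJ K J) x = (1 / 4) * ∑ l, pd K l (pd I i (pd J l U)) x := by
    have hdiff (l : Fin 3) := (hd2 K J l l).differentiableAt_of_isOpen hS hx
    rw [hUIJ, pd_const_mul _ (DifferentiableAt.fun_sum fun l _ => hdiff l),
      pd_sum _ fun l _ => hdiff l]
    simp_rw [pd_comm hS (hd1 J _) hx I K]
  have pd_zero (K : Fin m) (i : Fin 3) : pd K i (fun _ => (0 : ℝ)) = fun _ => 0 := by
    ext x
    simp [pd]
  intro x hx
  refine ⟨fun I J => ?_, fun I J K i => ?_, fun I J k => ?_, fun I J => ?_, ?_⟩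
  · simp only [hUIJ, pd_comm hS hsmooth hx I J]
  · rw [hpd K J I i x hx, hpd K I J i x hx]
    congr 1
    refine Finset.sum_congr rfl fun l _ => pd_congr hS (fun y hy => ?_) hx K l
    rw [hswap I J y hy, pd_comm hS hsmooth hy]
  · rw [hlin _ I J x hx]
    have h (l : Fin 3) := pd_pd_linField hS hsmooth hx (eps k) I J l l
    have hz (l : Fin 3) : pd I l (pd J l (linField (eps k) U)) x = 0 := by
      rw [pd_congr hS (fun y hy => pd_congr hS (fun z hz => hrot z hz k) hy J l) hx, pd_zero,
        pd_zero]
    have h0 := h 0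
    have h1 := h 1
    have h2 := h 2
    simp only [hz, Fin.sum_univ_three] at h0 h1 h2 ⊢
    fin_cases k <;> simp [eps] at h0 h1 h2 ⊢ <;> linarith
  · rw [hlin _ I J x hx]
    have h (l : Fin 3) := pd_pd_linField hS hsmooth hx (fun i j => if i = j then 1 else 0) I J l l
    have hz (l : Fin 3) :
        pd I l (pd J l (linField (fun i j => if i = j then 1 else 0) U)) x
          = pd I l (pd J l U) x :=
      pd_congr hS (fun y hy => pd_congr hS hhom hy J l) hx I l
    simp only [hz, ite_mul, one_mul, zero_mul, Finset.sum_ite_eq, Finset.mem_univ, if_true] at h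
    simp only [hUIJ, Fin.sum_univ_three]
    linarith [h 0, h 1, h 2]
  · have hcontr (J : Fin m) (i : Fin 3) :
        ∑ l, ∑ K, x K i * pd K l (pd J l U) x = 2 * pd J i U x := by
      have hr (k l : Fin 3) := pd_linField hS hsmooth hx (eps k) J l
      have hh := pd_linField hS hsmooth hx (fun i j => if i = j then 1 else 0) J i
      simp only [pd_congr hS (fun y hy => hrot y hy _) hx, pd_zero] at hr
      rw [pd_congr hS hhom hx] at hh
      have hsum (c : Fin 3 → Fin 3 → ℝ) (l : Fin 3) : linField c (pd J l U) x
          = ∑ i, ∑ j, c i j * ∑ K, x K i * pd K j (pd J l U) x := by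
        simp only [linField, Finset.mul_sum, mul_assoc]
        rw [Finset.sum_comm]
        exact Finset.sum_congr rfl fun i _ => Finset.sum_comm
      simp only [hsum] at hr hh
      have hG (i j l : Fin 3) : ∑ K, x K i * pd K j (pd J l U) x
          = ∑ K, x K i * pd K l (pd J j U) x :=
        Finset.sum_congr rfl fun K _ => by rw [hswap K J x hx]
      obtain ⟨G, hGdef⟩ : ∃ G : Fin 3 → Fin 3 → Fin 3 → ℝ,
          ∀ i j l, ∑ K, x K i * pd K j (pd J l U) x = G i j l := ⟨_, fun _ _ _ => rfl⟩
      simp only [hGdef] at hr hh hG ⊢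
      simp only [Fin.sum_univ_three] at hr hh ⊢
      have h01 := hr 0 1
      have h02 := hr 0 2
      have h10 := hr 1 0
      have h12 := hr 1 2
      have h20 := hr 2 0
      have h21 := hr 2 1
      simp [eps] at h01 h02 h10 h12 h20 h21
      fin_cases i <;> simp at hh ⊢ <;>
        linarith [hG 0 0 1, hG 0 0 2, hG 1 1 0, hG 1 1 2, hG 2 2 0, hG 2 2 1]
    have hJ (J : Fin m) : ∑ I, UIJ I J x * dot3 (x I) (x J)
        = (1 / 4) * ∑ i, x J i * ∑ l, ∑ K, x K i * pd K l (pd J l U) x := by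
      simp only [hUIJ, dot3, Fin.sum_univ_three, Finset.mul_sum, ← Finset.sum_add_distrib]
      refine Finset.sum_congr rfl fun K _ => ?_
      ring
    rw [Finset.sum_comm, ← hhom x hx, ← sum_dot3_grad]
    simp only [hJ, hcontr]
    simp only [dot3, grad, Finset.mul_sum]
    refine Finset.sum_congr rfl fun K _ => Finset.sum_congr rfl fun i _ => ?_
    ring
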